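/- arXiv:2405.07139 — 4 statements merged into one kernel-verified Lean document; each statement's English description precedes it below -/
import Mathlib

section
/- Let C ∈ ℝ^{n×n} be invertible, let M ∈ ℝ^{n×n} be symmetric positive definite, and let K ⊆ ℝⁿ be a nonzero subspace with W = C(K) = {Cv : v ∈ K}. Define γ = inf over v ≠ 0 of |(Cv, v)_M| / (v, v)_M and Γ = sup over v ≠ 0 of ‖Cv‖_M / ‖v‖_M. Then inf over nonzero v ∈ K of sup over nonzero w ∈ W of |(v, w)_M| / (‖v‖_M ‖w‖_M) ≥ γ/Γ. -/
open Matrix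

/-- The `M`-norm `‖v‖_M = √(vᵀ M v)`. -/
noncomputable def mnorm {n : ℕ} (M : Matrix (Fin n) (Fin n) ℝ) (v : Fin n → ℝ) : ℝ :=
  Real.sqrt (v ⬝ᵥ M *ᵥ v)

namespace Matrix

variable {ι : Type*} [Fintype ι] {M : Matrix ι ι ℝ}

theorem PosDef.real_dotProduct_mulVec_pos (hM : M.PosDef) {v : ι → ℝ} (hv : v ≠ 0) :
    0 < v ⬝ᵥ M *ᵥ v := by
  simpa using hM.dotProduct_mulVec_pos hv

theorem PosDef.real_dotProduct_mulVec_comm (hM : M.PosDef) (v w : ι → ℝ) :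
    v ⬝ᵥ M *ᵥ w = w ⬝ᵥ M *ᵥ v := by
  have hT : Mᵀ = M := by simpa using hM.isHermitian.eq
  rw [dotProduct_mulVec, ← mulVec_transpose, hT, dotProduct_comm]

end Matrix

theorem mnorm_pos {n : ℕ} {M : Matrix (Fin n) (Fin n) ℝ} (hM : M.PosDef) {v : Fin n → ℝ}
    (hv : v ≠ 0) : 0 < mnorm M v :=
  Real.sqrt_pos.2 (hM.real_dotProduct_mulVec_pos hv)

theorem mnorm_mul_self {n : ℕ} {M : Matrix (Fin n) (Fin n) ℝ} (hM : M.PosDef) {v : Fin n → ℝ}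
    (hv : v ≠ 0) : mnorm M v * mnorm M v = v ⬝ᵥ M *ᵥ v :=
  Real.mul_self_sqrt (hM.real_dotProduct_mulVec_pos hv).le

theorem stmt7 {n : ℕ} (C M : Matrix (Fin n) (Fin n) ℝ) (hC : IsUnit C) (hM : M.PosDef)
    (K : Submodule ℝ (Fin n → ℝ)) (hK : K ≠ ⊥)
    (W : Submodule ℝ (Fin n → ℝ)) (hW : W = K.map C.mulVecLin)
    (γ Γ : ℝ)
    -- `γ = inf_{v ≠ 0} |(Cv, v)_M| / (v, v)_M`, expressed as a lower bound
    (hγ : ∀ v : Fin n → ℝ, v ≠ 0 → γ * (v ⬝ᵥ M *ᵥ v) ≤ |(C *ᵥ v) ⬝ᵥ M *ᵥ v|)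
    -- `Γ = sup_{v ≠ 0} ‖Cv‖_M / ‖v‖_M`, expressed as an upper bound
    (hΓ : ∀ v : Fin n → ℝ, mnorm M (C *ᵥ v) ≤ Γ * mnorm M v) :
    -- `inf_{0 ≠ v ∈ K} sup_{0 ≠ w ∈ W} |(v, w)_M| / (‖v‖_M ‖w‖_M) ≥ γ/Γ`
    ∀ v ∈ K, v ≠ 0 → ∃ w ∈ W, w ≠ 0 ∧
      (γ / Γ) * (mnorm M v * mnorm M w) ≤ |v ⬝ᵥ M *ᵥ w| := by
  intro v hvK hv
  have hCv : C *ᵥ v ≠ 0 := fun h =>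
    hv (mulVec_injective_of_isUnit hC (h.trans (mulVec_zero C).symm))
  have hnv := mnorm_pos hM hv
  have hnw := mnorm_pos hM hCv
  have hΓ_pos : 0 < Γ := pos_of_mul_pos_left (hnw.trans_le (hΓ v)) hnv.le
  refine ⟨C *ᵥ v, hW ▸ Submodule.mem_map_of_mem hvK, hCv, ?_⟩
  rcases le_total γ 0 with hγ_sign | hγ_sign
  · exact (mul_nonpos_of_nonpos_of_nonneg (div_nonpos_of_nonpos_of_nonneg hγ_sign hΓ_pos.le)
      (mul_pos hnv hnw).le).trans (abs_nonneg _)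
  · calc γ / Γ * (mnorm M v * mnorm M (C *ᵥ v))
        ≤ γ / Γ * (mnorm M v * (Γ * mnorm M v)) := by gcongr; exact hΓ v
      _ = γ * (mnorm M v * mnorm M v) := by field_simp
      _ = γ * (v ⬝ᵥ M *ᵥ v) := by rw [mnorm_mul_self hM hv]
      _ ≤ |(C *ᵥ v) ⬝ᵥ M *ᵥ v| := hγ v hv
      _ = |v ⬝ᵥ M *ᵥ (C *ᵥ v)| := by rw [hM.real_dotProduct_mulVec_comm]
end

section
/- Let C ∈ ℝ^{n×n} be invertible, let M ∈ ℝ^{n×n} be symmetric positive definite, and let g ∈ ℝⁿ. For an integer j ≥ 1 let W_j = C(K_j(C, g)), with W_0 = {0}, and let P_{W_j} denote the orthogonal projection onto W_j with respect to the M-inner product. Define γ = inf over v ≠ 0 of |(Cv, v)_M| / (v, v)_M and Γ = sup over v ≠ 0 of ‖Cv‖_M / ‖v‖_M, and assume γ > 0. Then for every integer m ≥ 1, ‖g − P_{W_m}g‖_M² ≤ (1 − γ²/Γ²)·‖g − P_{W_{m−1}}g‖_M². -/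
open Matrix

/-- Krylov subspace `K_m(C, v) = span {v, Cv, ..., C^{m-1} v}`. -/
noncomputable def krylov {n : ℕ} (C : Matrix (Fin n) (Fin n) ℝ) (v : Fin n → ℝ) (m : ℕ) :
    Submodule ℝ (Fin n → ℝ) :=
  Submodule.span ℝ {w | ∃ k < m, w = (C ^ k) *ᵥ v}

lemma mnorm_sq {n : ℕ} {M : Matrix (Fin n) (Fin n) ℝ} (hM : M.PosDef) (v : Fin n → ℝ) :
    mnorm M v ^ 2 = v ⬝ᵥ M *ᵥ v :=
  Real.sq_sqrt (by simpa using hM.posSemidef.dotProduct_mulVec_nonneg v)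

lemma dotProduct_mulVec_comm_of_posDef {n : ℕ} {M : Matrix (Fin n) (Fin n) ℝ} (hM : M.PosDef)
    (v w : Fin n → ℝ) : v ⬝ᵥ M *ᵥ w = w ⬝ᵥ M *ᵥ v := by
  have hT : Mᵀ = M := by simpa [IsHermitian] using hM.isHermitian
  rw [dotProduct_mulVec, ← mulVec_transpose, hT, dotProduct_comm]

lemma krylov_mono {n : ℕ} (C : Matrix (Fin n) (Fin n) ℝ) (v : Fin n → ℝ) {k m : ℕ}
    (h : k ≤ m) : krylov C v k ≤ krylov C v m :=
  Submodule.span_mono fun _ ⟨j, hj, hw⟩ => ⟨j, hj.trans_le h, hw⟩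

lemma self_mem_krylov {n : ℕ} (C : Matrix (Fin n) (Fin n) ℝ) (v : Fin n → ℝ) {m : ℕ}
    (hm : 1 ≤ m) : v ∈ krylov C v m :=
  Submodule.subset_span ⟨0, hm, by simp⟩

lemma map_krylov_le_krylov_succ {n : ℕ} (C : Matrix (Fin n) (Fin n) ℝ) (v : Fin n → ℝ) (m : ℕ) :
    (krylov C v m).map C.mulVecLin ≤ krylov C v (m + 1) := by
  rw [krylov, Submodule.map_span_le]
  rintro _ ⟨k, hk, rfl⟩
  exact Submodule.subset_span ⟨k + 1, by omega, by simp [pow_succ']⟩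

/-- The `M`-orthogonal projection onto a subspace is a best approximation in the `M`-norm. -/
lemma dotProduct_mulVec_sub_le_of_orthogonal {n : ℕ} {M : Matrix (Fin n) (Fin n) ℝ}
    (hM : M.PosDef) {W : Submodule ℝ (Fin n → ℝ)} {g p w : Fin n → ℝ} (hp : p ∈ W)
    (horth : ∀ w ∈ W, (g - p) ⬝ᵥ M *ᵥ w = 0) (hw : w ∈ W) :
    (g - p) ⬝ᵥ M *ᵥ (g - p) ≤ (g - w) ⬝ᵥ M *ᵥ (g - w) := by
  have h0 := horth _ (W.sub_mem hp hw)
  have h1 : 0 ≤ (p - w) ⬝ᵥ M *ᵥ (p - w) := by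
    simpa using hM.posSemidef.dotProduct_mulVec_nonneg (p - w)
  have h2 := dotProduct_mulVec_comm_of_posDef hM (p - w) (g - p)
  have h3 : g - w = (g - p) + (p - w) := by abel
  rw [h3, mulVec_add, dotProduct_add, add_dotProduct, add_dotProduct]
  linarith

theorem stmt8 {n : ℕ} (C M : Matrix (Fin n) (Fin n) ℝ) (hC : IsUnit C) (hM : M.PosDef)
    (g : Fin n → ℝ) (γ Γ : ℝ) (hγpos : 0 < γ)
    -- `γ = inf_{v ≠ 0} |(Cv, v)_M| / (v, v)_M`, expressed as a lower bound
    (hγ : ∀ v : Fin n → ℝ, v ≠ 0 → γ * (v ⬝ᵥ M *ᵥ v) ≤ |(C *ᵥ v) ⬝ᵥ M *ᵥ v|)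
    -- `Γ = sup_{v ≠ 0} ‖Cv‖_M / ‖v‖_M`, expressed as an upper bound
    (hΓ : ∀ v : Fin n → ℝ, mnorm M (C *ᵥ v) ≤ Γ * mnorm M v)
    (m : ℕ) (hm : 1 ≤ m) (p q : Fin n → ℝ)
    -- `p = P_{W_m} g` : the `M`-orthogonal projection of `g` onto `W_m = C(K_m(C,g))`
    (hp : p ∈ (krylov C g m).map C.mulVecLin)
    (hp' : ∀ w ∈ (krylov C g m).map C.mulVecLin, (g - p) ⬝ᵥ M *ᵥ w = 0)
    -- `q = P_{W_{m-1}} g` (note `K_0(C,g) = {0}`, so `W_0 = {0}`)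
    (hq : q ∈ (krylov C g (m - 1)).map C.mulVecLin)
    (hq' : ∀ w ∈ (krylov C g (m - 1)).map C.mulVecLin, (g - q) ⬝ᵥ M *ᵥ w = 0) :
    mnorm M (g - p) ^ 2 ≤ (1 - γ ^ 2 / Γ ^ 2) * mnorm M (g - q) ^ 2 := by
  set r := g - q with hr
  have hmono : (krylov C g (m - 1)).map C.mulVecLin ≤ (krylov C g m).map C.mulVecLin :=
    Submodule.map_mono (krylov_mono C g (Nat.sub_le m 1))
  have hrK : r ∈ krylov C g m := by
    refine Submodule.sub_mem _ (self_mem_krylov C g hm) ?_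
    simpa [Nat.sub_add_cancel hm] using map_krylov_le_krylov_succ C g (m - 1) hq
  have hCr : C *ᵥ r ∈ (krylov C g m).map C.mulVecLin := ⟨r, hrK, rfl⟩
  have hbest (α : ℝ) : (g - p) ⬝ᵥ M *ᵥ (g - p) ≤ r ⬝ᵥ M *ᵥ r
      - 2 * α * ((C *ᵥ r) ⬝ᵥ M *ᵥ r) + α ^ 2 * ((C *ᵥ r) ⬝ᵥ M *ᵥ (C *ᵥ r)) := by
    have h := dotProduct_mulVec_sub_le_of_orthogonal hM hp hp'
      (Submodule.add_mem _ (hmono hq) (Submodule.smul_mem _ α hCr))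
    have hsub : g - (q + α • C *ᵥ r) = r - α • C *ᵥ r := by rw [hr]; abel
    rw [hsub] at h
    refine h.trans_eq ?_
    clear_value r
    rw [mulVec_sub, dotProduct_sub, sub_dotProduct, sub_dotProduct, mulVec_smul,
      dotProduct_smul, dotProduct_smul, smul_dotProduct, smul_dotProduct,
      dotProduct_mulVec_comm_of_posDef hM r (C *ᵥ r)]
    simp only [smul_eq_mul]
    ring
  rw [mnorm_sq hM, mnorm_sq hM]
  rcases eq_or_ne r 0 with h0 | h0
  · simpa [h0] using hbest 0
  have ha : 0 < r ⬝ᵥ M *ᵥ r := by simpa using hM.dotProduct_mulVec_pos h0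
  have hb := hγ r h0
  have hc : (C *ᵥ r) ⬝ᵥ M *ᵥ (C *ᵥ r) ≤ Γ ^ 2 * (r ⬝ᵥ M *ᵥ r) := by
    rw [← mnorm_sq hM, ← mnorm_sq hM, ← mul_pow]
    exact pow_le_pow_left₀ (Real.sqrt_nonneg _) (hΓ r) 2
  have hCr0 : C *ᵥ r ≠ 0 := by
    intro h
    rw [h, zero_dotProduct, abs_zero] at hb
    exact absurd hb (not_le.2 (mul_pos hγpos ha))
  have hcpos : 0 < (C *ᵥ r) ⬝ᵥ M *ᵥ (C *ᵥ r) := by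
    simpa using hM.dotProduct_mulVec_pos hCr0
  have hα := hbest ((C *ᵥ r) ⬝ᵥ M *ᵥ r / ((C *ᵥ r) ⬝ᵥ M *ᵥ (C *ᵥ r)))
  generalize (g - p) ⬝ᵥ M *ᵥ (g - p) = P at *
  generalize r ⬝ᵥ M *ᵥ r = a at *
  generalize (C *ᵥ r) ⬝ᵥ M *ᵥ r = b at *
  generalize (C *ᵥ r) ⬝ᵥ M *ᵥ (C *ᵥ r) = c at *
  have hbsq : (γ * a) ^ 2 ≤ b ^ 2 := by
    rw [← sq_abs b]
    exact pow_le_pow_left₀ (by positivity) hb 2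
  have hΓ2 : 0 < Γ ^ 2 := pos_of_mul_pos_left (hcpos.trans_le hc) ha.le
  have hmin : P ≤ a - b ^ 2 / c := by
    refine hα.trans_eq ?_
    field_simp
    ring
  have hquot : γ ^ 2 / Γ ^ 2 * a ≤ b ^ 2 / c := by
    calc γ ^ 2 / Γ ^ 2 * a = (γ * a) ^ 2 / (Γ ^ 2 * a) := by field_simp
      _ ≤ b ^ 2 / c := by gcongr
  linarith
end

section
/- Let A ∈ ℝ^{n×n}, let M, M' ∈ ℝ^{n×n} be symmetric positive definite, and let K, L ⊆ ℝⁿ be subspaces of the same finite dimension. Assume there exist constants α, β > 0 such that vᵀAᵀw ≤ α‖v‖_M‖w‖_{M'} for all v, w ∈ ℝⁿ (i.e., (Av, w) ≤ α‖v‖_M‖w‖_{M'}), and inf over nonzero v ∈ K of sup over nonzero w ∈ L of (Av, w) / (‖v‖_M‖w‖_{M'}) ≥ β. Then for every v ∈ ℝⁿ there exists a unique Pv ∈ K with (A(Pv), w) = (Av, w) for all w ∈ L, the map P is linear and idempotent, and ‖Pv‖_M ≤ (α/β)‖v‖_M for all v ∈ ℝⁿ. -/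
open Matrix

open Module in
/-- The Petrov–Galerkin projection onto a trial space `K` along a test space `L` of the same
dimension, for a bilinear form whose left kernel on `K × L` is trivial. -/
theorem exists_petrovGalerkin_projection {V W : Type*} [AddCommGroup V] [Module ℝ V]
    [AddCommGroup W] [Module ℝ W] (B : V →ₗ[ℝ] W →ₗ[ℝ] ℝ)
    (K : Submodule ℝ V) (L : Submodule ℝ W) [FiniteDimensional ℝ K] [FiniteDimensional ℝ L]
    (hdim : finrank ℝ K = finrank ℝ L)
    (hinj : ∀ v ∈ K, (∀ w ∈ L, B v w = 0) → v = 0) :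
    ∃ P : V →ₗ[ℝ] V, ∀ v, P v ∈ K ∧ ∀ w ∈ L, B (P v) w = B v w := by
  let Φ : V →ₗ[ℝ] Dual ℝ L := L.subtype.dualMap ∘ₗ B
  have hΦ : Function.Injective (Φ ∘ₗ K.subtype) := by
    refine (injective_iff_map_eq_zero _).2 fun v hv => Subtype.ext (hinj v v.2 fun w hw => ?_)
    exact LinearMap.congr_fun hv ⟨w, hw⟩
  let e : K ≃ₗ[ℝ] Dual ℝ L := LinearEquiv.ofInjectiveOfFinrankEq (Φ ∘ₗ K.subtype) hΦ
    (hdim.trans Subspace.dual_finrank_eq.symm)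
  refine ⟨K.subtype ∘ₗ e.symm.toLinearMap ∘ₗ Φ, fun v => ⟨(e.symm (Φ v)).2, fun w hw => ?_⟩⟩
  exact LinearMap.congr_fun (e.apply_symm_apply (Φ v)) ⟨w, hw⟩

theorem stmt10 {n : ℕ} (A M M' : Matrix (Fin n) (Fin n) ℝ)
    (hM : M.PosDef) (hM' : M'.PosDef)
    (K L : Submodule ℝ (Fin n → ℝ))
    (hdim : Module.finrank ℝ K = Module.finrank ℝ L)
    (α β : ℝ) (hαpos : 0 < α) (hβpos : 0 < β)
    -- boundedness: `(Av, w) ≤ α ‖v‖_M ‖w‖_{M'}`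
    (hα : ∀ v w : Fin n → ℝ, w ⬝ᵥ A *ᵥ v ≤ α * mnorm M v * mnorm M' w)
    -- inf-sup: `inf_{0 ≠ v ∈ K} sup_{0 ≠ w ∈ L} (Av, w)/(‖v‖_M ‖w‖_{M'}) ≥ β`
    (hβ : ∀ v ∈ K, v ≠ 0 → ∃ w ∈ L, w ≠ 0 ∧
      β * (mnorm M v * mnorm M' w) ≤ w ⬝ᵥ A *ᵥ v) :
    ∃ Pr : (Fin n → ℝ) →ₗ[ℝ] (Fin n → ℝ),
      (∀ v : Fin n → ℝ,
        (Pr v ∈ K ∧ ∀ w ∈ L, w ⬝ᵥ A *ᵥ (Pr v) = w ⬝ᵥ A *ᵥ v) ∧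
        -- uniqueness of the Petrov–Galerkin projection
        ∀ p ∈ K, (∀ w ∈ L, w ⬝ᵥ A *ᵥ p = w ⬝ᵥ A *ᵥ v) → p = Pr v) ∧
      Pr ∘ₗ Pr = Pr ∧
      ∀ v : Fin n → ℝ, mnorm M (Pr v) ≤ (α / β) * mnorm M v := by
  have hinj : ∀ v ∈ K, (∀ w ∈ L, w ⬝ᵥ A *ᵥ v = 0) → v = 0 := by
    intro v hv h
    by_contra hv0
    obtain ⟨w, hw, hw0, hle⟩ := hβ v hv hv0
    have := mul_pos hβpos (mul_pos (mnorm_pos hM hv0) (mnorm_pos hM' hw0))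
    linarith [h w hw]
  obtain ⟨P, hP⟩ := exists_petrovGalerkin_projection (LinearMap.flip (Matrix.toBilin' A)) K L hdim
    (by simpa only [LinearMap.flip_apply, Matrix.toBilin'_apply'] using hinj)
  simp only [LinearMap.flip_apply, Matrix.toBilin'_apply'] at hP
  have huniq : ∀ v, ∀ p ∈ K, (∀ w ∈ L, w ⬝ᵥ A *ᵥ p = w ⬝ᵥ A *ᵥ v) → p = P v := by
    intro v p hp h
    refine sub_eq_zero.1 (hinj _ (K.sub_mem hp (hP v).1) fun w hw => ?_)
    rw [Matrix.mulVec_sub, dotProduct_sub, h w hw, (hP v).2 w hw, sub_self]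
  refine ⟨P, fun v => ⟨hP v, huniq v⟩, ?_, fun v => ?_⟩
  · exact LinearMap.ext fun v => (huniq _ _ (hP _).1 fun _ _ => rfl).symm
  · by_cases h0 : P v = 0
    · rw [h0]
      simpa [mnorm] using mul_nonneg (div_pos hαpos hβpos).le (Real.sqrt_nonneg _)
    · obtain ⟨w, hw, hw0, hle⟩ := hβ _ (hP v).1 h0
      rw [(hP v).2 w hw] at hle
      have hle' : β * mnorm M (P v) * mnorm M' w ≤ α * mnorm M v * mnorm M' w := by
        linarith [hα v w]
      have := le_of_mul_le_mul_right hle' (mnorm_pos hM' hw0)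
      rw [div_mul_eq_mul_div, le_div_iff₀ hβpos]
      linarith
end

section
/- Let A₁ ∈ ℝ^{n×n} be symmetric positive definite and let A₂ ∈ ℝ^{n×n} satisfy vᵀA₂v = 0 for all v ∈ ℝⁿ and |wᵀA₂v| ≤ C_b‖v‖_{A₁}‖w‖_{A₁} for all v, w ∈ ℝⁿ, for some constant C_b ≥ 0. For μ = (ν₁, ν₂) set A(μ) = ν₁A₁ + cos(ν₂)A₂, and assume 0 < μ̲ ≤ ν₁ ≤ μ̄. Let B = A₁⁻¹, M = A₁, f ∈ ℝⁿ, u_μ = A(μ)⁻¹f, and fix μ₁ = (ν₁', ν₂') with 0 < μ̲ ≤ ν₁' ≤ μ̄ and cos(ν₂') ≠ 0. For an integer m ≥ 1, let K_m = K_m(BA(μ₁), Bf) and let û_μ ∈ K_m minimize ‖Bf − BA(μ)v‖_M over v ∈ K_m. Then for every μ with cos(ν₂) ≠ 0, ‖BA(μ)(u_μ − û_μ)‖_M ≤ (1 − μ̲²/(μ̄ + C_b)²)^{m/2} · ‖Bf‖_M. -/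
open Matrix

/-- The Krylov subspaces are nested. -/
theorem krylov_le_succ {n : ℕ} (C : Matrix (Fin n) (Fin n) ℝ) (v : Fin n → ℝ) (m : ℕ) :
    krylov C v m ≤ krylov C v (m + 1) := by
  refine Submodule.span_mono ?_
  rintro w ⟨k, hk, rfl⟩
  exact ⟨k, by omega, rfl⟩

/-- Applying `C` to an element of `K_m(C, v)` gives an element of `K_{m+1}(C, v)`. -/
theorem mulVec_mem_krylov_succ {n : ℕ} (C : Matrix (Fin n) (Fin n) ℝ) (v : Fin n → ℝ) (m : ℕ)
    {q : Fin n → ℝ} (hq : q ∈ krylov C v m) : C *ᵥ q ∈ krylov C v (m + 1) := by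
  have h : krylov C v m ≤ (krylov C v (m + 1)).comap C.mulVecLin := by
    refine Submodule.span_le.2 ?_
    rintro w ⟨k, hk, rfl⟩
    refine Submodule.subset_span ⟨k + 1, by omega, ?_⟩
    simp [Matrix.mulVec_mulVec, pow_succ']
  exact h hq

/-- If `x ↦ x - ω T x` contracts the quadratic form `d` by the factor `ρ` and `T = α + β C`, then
some residual `b - T q` with `q ∈ K_m(C, b)` satisfies `d (b - T q) ≤ ρ ^ m * d b`. -/
theorem exists_mem_krylov_residual_le {n : ℕ} {C T : Matrix (Fin n) (Fin n) ℝ} {α β ω ρ : ℝ}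
    {d : (Fin n → ℝ) → ℝ} (hT : T = α • (1 : Matrix (Fin n) (Fin n) ℝ) + β • C) (hρ : 0 ≤ ρ)
    (hd : ∀ x, d (x - ω • T *ᵥ x) ≤ ρ * d x) (b : Fin n → ℝ) (m : ℕ) :
    ∃ q ∈ krylov C b m, d (b - T *ᵥ q) ≤ ρ ^ m * d b := by
  induction m with
  | zero => exact ⟨0, Submodule.zero_mem _, by simp⟩
  | succ m ih =>
    obtain ⟨q, hq, hle⟩ := ih
    have hb : b ∈ krylov C b (m + 1) := Submodule.subset_span ⟨0, by omega, by simp⟩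
    have hq' := krylov_le_succ C b m hq
    have hTq : T *ᵥ q ∈ krylov C b (m + 1) := by
      rw [hT, Matrix.add_mulVec, Matrix.smul_mulVec, Matrix.smul_mulVec, Matrix.one_mulVec]
      exact Submodule.add_mem _ (Submodule.smul_mem _ _ hq')
        (Submodule.smul_mem _ _ (mulVec_mem_krylov_succ C b m hq))
    refine ⟨q + ω • (b - T *ᵥ q), Submodule.add_mem _ hq'
      (Submodule.smul_mem _ _ (Submodule.sub_mem _ hb hTq)), ?_⟩
    have h : b - T *ᵥ (q + ω • (b - T *ᵥ q)) =
        (b - T *ᵥ q) - ω • T *ᵥ (b - T *ᵥ q) := by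
      rw [Matrix.mulVec_add, Matrix.mulVec_smul]
      abel
    rw [h, pow_succ']
    calc _ ≤ ρ * d (b - T *ᵥ q) := hd _
      _ ≤ ρ * (ρ ^ m * d b) := mul_le_mul_of_nonneg_left hle hρ
      _ = _ := by ring

/-- One Richardson step with parameter `ν / L ^ 2` for `T = ν + c A₁⁻¹ A₂`, where `A₂` is
skew-symmetric, contracts the squared `A₁`-norm by the factor `1 - ν ^ 2 / L ^ 2`. -/
theorem richardson_step_le {n : ℕ} {A₁ A₂ : Matrix (Fin n) (Fin n) ℝ} (hA₁ : A₁.PosDef)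
    {Cb : ℝ} (hCb : 0 ≤ Cb) (hskew : ∀ v : Fin n → ℝ, v ⬝ᵥ A₂ *ᵥ v = 0)
    (hbound : ∀ v w : Fin n → ℝ, |w ⬝ᵥ A₂ *ᵥ v| ≤ Cb * mnorm A₁ v * mnorm A₁ w)
    {ν c L : ℝ} (hν : 0 < ν) (hc : |c| ≤ 1) (hL : ν + Cb ≤ L) (x : Fin n → ℝ) :
    (x - (ν / L ^ 2) • (ν • 1 + c • (A₁⁻¹ * A₂)) *ᵥ x) ⬝ᵥ
        A₁ *ᵥ (x - (ν / L ^ 2) • (ν • 1 + c • (A₁⁻¹ * A₂)) *ᵥ x) ≤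
      (1 - ν ^ 2 / L ^ 2) * (x ⬝ᵥ A₁ *ᵥ x) := by
  have hdet : IsUnit A₁.det := hA₁.det_pos.ne'.isUnit
  obtain ⟨s, hs⟩ : ∃ s, s = (A₁⁻¹ * A₂) *ᵥ x := ⟨_, rfl⟩
  have hA₁s : A₁ *ᵥ s = A₂ *ᵥ x := by
    rw [hs, Matrix.mulVec_mulVec, ← Matrix.mul_assoc, Matrix.mul_nonsing_inv _ hdet,
      Matrix.one_mul]
  have hsym : s ⬝ᵥ A₁ *ᵥ x = 0 := by
    have hT : A₁ᵀ = A₁ := by simpa using hA₁.isHermitian.eq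
    rw [Matrix.dotProduct_mulVec, ← Matrix.mulVec_transpose, hT, hA₁s, dotProduct_comm, hskew]
  have hx : 0 ≤ x ⬝ᵥ A₁ *ᵥ x := by simpa using hA₁.posSemidef.dotProduct_mulVec_nonneg x
  have hs0 : 0 ≤ s ⬝ᵥ A₁ *ᵥ s := by simpa using hA₁.posSemidef.dotProduct_mulVec_nonneg s
  have hsle : s ⬝ᵥ A₁ *ᵥ s ≤ Cb ^ 2 * (x ⬝ᵥ A₁ *ᵥ x) := by
    have h := (le_abs_self _).trans (hbound x s)
    rw [← hA₁s] at h
    unfold mnorm at h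
    have h1 := Real.sq_sqrt hx
    have h2 := Real.sq_sqrt hs0
    have h3 := Real.sqrt_nonneg (x ⬝ᵥ A₁ *ᵥ x)
    have h4 := Real.sqrt_nonneg (s ⬝ᵥ A₁ *ᵥ s)
    set X := √(x ⬝ᵥ A₁ *ᵥ x)
    set S := √(s ⬝ᵥ A₁ *ᵥ s)
    rw [← h1, ← h2, ← mul_pow]
    refine pow_le_pow_left₀ h4 ?_ 2
    rcases h4.eq_or_lt with h0 | h0
    · rw [← h0]; positivity
    · refine le_of_mul_le_mul_right ?_ h0
      rw [← h2] at h
      linarith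
  set ω := ν / L ^ 2 with hω
  have hL0 : 0 < L := by linarith
  have hexp : (x - ω • (ν • 1 + c • (A₁⁻¹ * A₂)) *ᵥ x) = (1 - ω * ν) • x - (ω * c) • s := by
    rw [Matrix.add_mulVec, Matrix.smul_mulVec, Matrix.smul_mulVec, Matrix.one_mulVec, ← hs]
    module
  rw [hexp]
  have hsq : ((1 - ω * ν) • x - (ω * c) • s) ⬝ᵥ A₁ *ᵥ ((1 - ω * ν) • x - (ω * c) • s) =
      (1 - ω * ν) ^ 2 * (x ⬝ᵥ A₁ *ᵥ x) + ω ^ 2 * c ^ 2 * (s ⬝ᵥ A₁ *ᵥ s) := by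
    have hxs : x ⬝ᵥ A₁ *ᵥ s = 0 := by rw [hA₁s, hskew]
    simp only [Matrix.mulVec_sub, Matrix.mulVec_smul, sub_dotProduct, dotProduct_sub,
      smul_dotProduct, dotProduct_smul, smul_eq_mul, hsym, hxs]
    ring
  rw [hsq]
  have hc2 : c ^ 2 ≤ 1 := by rw [← sq_abs]; exact pow_le_one₀ (abs_nonneg c) hc
  have hcs : c ^ 2 * (s ⬝ᵥ A₁ *ᵥ s) ≤ Cb ^ 2 * (x ⬝ᵥ A₁ *ᵥ x) :=
    (mul_le_of_le_one_left hs0 hc2).trans hsle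
  have hLsq : ν ^ 2 + Cb ^ 2 ≤ L ^ 2 := by nlinarith
  have hωL : ω * L ^ 2 = ν := by rw [hω]; field_simp
  have hων : ν ^ 2 / L ^ 2 = ω * ν := by rw [hω]; ring
  have hωsq : ω ^ 2 * (ν ^ 2 + Cb ^ 2) ≤ ω * ν := by
    calc _ ≤ ω ^ 2 * L ^ 2 := by gcongr
      _ = ω * (ω * L ^ 2) := by ring
      _ = _ := by rw [hωL]
  rw [hων]
  have hfin := mul_le_mul_of_nonneg_left hcs (sq_nonneg ω)
  have hfin' := mul_le_mul_of_nonneg_right hωsq hx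
  nlinarith

theorem stmt15 {n : ℕ} (A₁ A₂ : Matrix (Fin n) (Fin n) ℝ) (hA₁ : A₁.PosDef)
    (Cb : ℝ) (hCb : 0 ≤ Cb)
    -- `vᵀ A₂ v = 0` for all `v`
    (hskew : ∀ v : Fin n → ℝ, v ⬝ᵥ A₂ *ᵥ v = 0)
    -- `|wᵀ A₂ v| ≤ C_b ‖v‖_{A₁} ‖w‖_{A₁}`
    (hbound : ∀ v w : Fin n → ℝ, |w ⬝ᵥ A₂ *ᵥ v| ≤ Cb * mnorm A₁ v * mnorm A₁ w)
    (μlo μhi : ℝ) (hμlo : 0 < μlo)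
    (A : ℝ × ℝ → Matrix (Fin n) (Fin n) ℝ)
    (hA : ∀ p : ℝ × ℝ, A p = p.1 • A₁ + Real.cos p.2 • A₂)
    (ν₁ ν₂ ν₁' ν₂' : ℝ)
    (h₁ : μlo ≤ ν₁) (h₂ : ν₁ ≤ μhi) (h₃ : μlo ≤ ν₁') (h₄ : ν₁' ≤ μhi)
    (hcos₁ : Real.cos ν₂' ≠ 0) (hcos : Real.cos ν₂ ≠ 0)
    (B M : Matrix (Fin n) (Fin n) ℝ) (hB : B = A₁⁻¹) (hM : M = A₁)
    (f u : Fin n → ℝ) (hu : u = (A (ν₁, ν₂))⁻¹ *ᵥ f)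
    (m : ℕ) (hm : 1 ≤ m)
    (uhat : Fin n → ℝ)
    -- `uhat` minimizes `‖Bf − B A(μ) v‖_M` over `K_m = K_m(B A(μ₁), B f)`
    (huhat : uhat ∈ krylov (B * A (ν₁', ν₂')) (B *ᵥ f) m)
    (hminz : ∀ v ∈ krylov (B * A (ν₁', ν₂')) (B *ᵥ f) m,
      mnorm M (B *ᵥ f - (B * A (ν₁, ν₂)) *ᵥ uhat) ≤
        mnorm M (B *ᵥ f - (B * A (ν₁, ν₂)) *ᵥ v)) :
    mnorm M ((B * A (ν₁, ν₂)) *ᵥ (u - uhat)) ≤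
      (1 - μlo ^ 2 / (μhi + Cb) ^ 2) ^ ((m : ℝ) / 2) * mnorm M (B *ᵥ f) := by
  have hdet : IsUnit A₁.det := hA₁.det_pos.ne'.isUnit
  have hBA : ∀ p : ℝ × ℝ, B * A p = p.1 • 1 + Real.cos p.2 • (A₁⁻¹ * A₂) := fun p ↦ by
    rw [hA, hB, Matrix.mul_add, Matrix.mul_smul, Matrix.mul_smul,
      Matrix.nonsing_inv_mul _ hdet]
  have hν : 0 < ν₁ := hμlo.trans_le h₁
  have hunit : IsUnit (A (ν₁, ν₂)) := by
    rw [← Matrix.mulVec_injective_iff_isUnit, ← Matrix.coe_mulVecLin,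
      ← LinearMap.ker_eq_bot, LinearMap.ker_eq_bot']
    intro v hv
    by_contra hne
    have hpos : 0 < v ⬝ᵥ A₁ *ᵥ v := by simpa using hA₁.dotProduct_mulVec_pos hne
    have h0 : v ⬝ᵥ A (ν₁, ν₂) *ᵥ v = 0 := by
      rw [← Matrix.mulVecLin_apply, hv, dotProduct_zero]
    rw [hA, Matrix.add_mulVec, Matrix.smul_mulVec, Matrix.smul_mulVec, dotProduct_add,
      dotProduct_smul, dotProduct_smul, hskew, smul_zero, add_zero, smul_eq_mul] at h0
    exact (mul_pos hν hpos).ne' h0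
  have hres : (B * A (ν₁, ν₂)) *ᵥ (u - uhat) = B *ᵥ f - (B * A (ν₁, ν₂)) *ᵥ uhat := by
    rw [Matrix.mulVec_sub, hu, Matrix.mulVec_mulVec, Matrix.mul_assoc,
      Matrix.mul_nonsing_inv _ ((Matrix.isUnit_iff_isUnit_det _).1 hunit), Matrix.mul_one]
  set θ := μlo ^ 2 / (μhi + Cb) ^ 2 with hθ
  have hL : 0 < μhi + Cb := by linarith
  have hρ : 0 ≤ 1 - θ := by
    rw [hθ, sub_nonneg, div_le_one (by positivity)]
    exact pow_le_pow_left₀ hμlo.le (by linarith) 2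
  have hstep : ∀ x : Fin n → ℝ,
      (x - (ν₁ / (μhi + Cb) ^ 2) • (B * A (ν₁, ν₂)) *ᵥ x) ⬝ᵥ
        A₁ *ᵥ (x - (ν₁ / (μhi + Cb) ^ 2) • (B * A (ν₁, ν₂)) *ᵥ x) ≤
      (1 - θ) * (x ⬝ᵥ A₁ *ᵥ x) := fun x ↦ by
    have hx : 0 ≤ x ⬝ᵥ A₁ *ᵥ x := by simpa using hA₁.posSemidef.dotProduct_mulVec_nonneg x
    rw [hBA]
    refine (richardson_step_le hA₁ hCb hskew hbound hν (Real.abs_cos_le_one ν₂)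
      (by linarith) x).trans ?_
    rw [hθ]
    gcongr
  have hTC : B * A (ν₁, ν₂) = (ν₁ - Real.cos ν₂ / Real.cos ν₂' * ν₁') •
      (1 : Matrix (Fin n) (Fin n) ℝ) +
      (Real.cos ν₂ / Real.cos ν₂') • (B * A (ν₁', ν₂')) := by
    rw [hBA, hBA, smul_add, smul_smul, smul_smul, div_mul_cancel₀ _ hcos₁]
    module
  obtain ⟨q, hq, hle⟩ := exists_mem_krylov_residual_le (d := fun x ↦ x ⬝ᵥ A₁ *ᵥ x) hTC hρ
    hstep (B *ᵥ f) m
  rw [hres]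
  refine (hminz q hq).trans ?_
  have hpow : (1 - θ) ^ ((m : ℝ) / 2) = √((1 - θ) ^ m) := by
    rw [Real.sqrt_eq_rpow, ← Real.rpow_natCast, ← Real.rpow_mul hρ]
    ring_nf
  rw [hpow, hM, mnorm, mnorm, ← Real.sqrt_mul (pow_nonneg hρ m)]
  exact Real.sqrt_le_sqrt hle
end
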